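/- Let X be a set and k_in a strictly positive definite kernel on X. Then k_in satisfies condition (i); consequently the canonical pseudometric d_E of the double sum kernel k_0 is a metric on S_fin(X). -/

import Mathlib

open scoped BigOperators

/-- The double sum kernel associated with a kernel `kin` on `X`, defined on finite subsets. -/
noncomputable def doubleSumKernel {X : Type*} (kin : X → X → ℝ) (S S' : Finset X) : ℝ :=
  (1 / ((S.card : ℝ) * (S'.card : ℝ))) * ∑ x ∈ S, ∑ x' ∈ S', kin x x'

/-- The canonical distance associated with the double sum kernel. -/
noncomputable def dE {X : Type*} (kin : X → X → ℝ) (S S' : Finset X) : ℝ :=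
  Real.sqrt (doubleSumKernel kin S S + doubleSumKernel kin S' S'
    - 2 * doubleSumKernel kin S S')

/-- Condition (i): for all `n₁, n₂ ≥ 1`, `ℓ ≤ min n₁ n₂` with `n := n₁ + n₂ - ℓ ≥ 2` and not
`(ℓ = n₁ ∧ ℓ = n₂)`, and all pairwise distinct `x₁, …, xₙ`, the corresponding quadratic form
with coefficients `1/n₁`, `1/n₁ - 1/n₂`, `-1/n₂` is positive. -/
def CondI {X : Type*} (kin : X → X → ℝ) : Prop :=
  ∀ (n₁ n₂ ℓ : ℕ), 1 ≤ n₁ → 1 ≤ n₂ → ℓ ≤ min n₁ n₂ →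
    2 ≤ n₁ + n₂ - ℓ → ¬(ℓ = n₁ ∧ ℓ = n₂) →
    ∀ (x : Fin (n₁ + n₂ - ℓ) → X), Function.Injective x →
      0 < ∑ i : Fin (n₁ + n₂ - ℓ), ∑ j : Fin (n₁ + n₂ - ℓ),
        (if (i : ℕ) < n₁ - ℓ then (1 : ℝ) / (n₁ : ℝ)
          else if (i : ℕ) < n₁ then 1 / (n₁ : ℝ) - 1 / (n₂ : ℝ) else -(1 / (n₂ : ℝ))) *
        (if (j : ℕ) < n₁ - ℓ then (1 : ℝ) / (n₁ : ℝ)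
          else if (j : ℕ) < n₁ then 1 / (n₁ : ℝ) - 1 / (n₂ : ℝ) else -(1 / (n₂ : ℝ))) *
        kin (x i) (x j)

/-- A strictly positive definite kernel has positive quadratic forms indexed by finite sets. -/
theorem quadratic_form_pos_of_strictPosDef {X : Type*} (kin : X → X → ℝ)
    (hspd : ∀ (n : ℕ) (t : Fin n → X), Function.Injective t →
      ∀ a : Fin n → ℝ, a ≠ 0 → 0 < ∑ i, ∑ j, a i * a j * kin (t i) (t j))
    (U : Finset X) (c : X → ℝ) (hc : ∃ x ∈ U, c x ≠ 0) :
    0 < ∑ x ∈ U, ∑ y ∈ U, c x * c y * kin x y := by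
  obtain ⟨x, hx, hcx⟩ := hc
  have h := hspd U.card (fun i => (U.equivFin.symm i : X))
    (Subtype.val_injective.comp U.equivFin.symm.injective)
    (fun i => c (U.equivFin.symm i)) (fun h0 => hcx (by
      simpa using congrFun h0 (U.equivFin ⟨x, hx⟩)))
  have reindex (f : X → ℝ) : ∑ i, f (U.equivFin.symm i) = ∑ x ∈ U, f x := by
    rw [Equiv.sum_comp U.equivFin.symm (fun z : U => f z), Finset.sum_coe_sort U f]
  rw [← reindex fun x => ∑ y ∈ U, c x * c y * kin x y]
  exact h.trans_eq (Finset.sum_congr rfl fun i _ =>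
    reindex fun y => c (U.equivFin.symm i) * c y * kin (U.equivFin.symm i) y)

open Classical in
/-- The density on `X` of the uniform probability measure on `S`. -/
noncomputable def uniformWeight {X : Type*} (S : Finset X) (x : X) : ℝ :=
  if x ∈ S then 1 / (S.card : ℝ) else 0

theorem uniformWeight_injective {X : Type*} {S S' : Finset X} (hS : S.Nonempty)
    (hS' : S'.Nonempty) (h : ∀ x, x ∈ S ∨ x ∈ S' → uniformWeight S x = uniformWeight S' x) :
    S = S' := by
  have h1 : (1 : ℝ) / S.card ≠ 0 := by simpa using hS.ne_empty
  have h2 : (1 : ℝ) / S'.card ≠ 0 := by simpa using hS'.ne_empty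
  ext x
  have hx := h x
  unfold uniformWeight at hx
  by_cases ha : x ∈ S <;> by_cases hb : x ∈ S' <;>
    simp_all [eq_comm (a := (0 : ℝ))]

theorem sum_uniformWeight_mul {X : Type*} {S U : Finset X} (hSU : S ⊆ U) (f : X → ℝ) :
    ∑ x ∈ U, uniformWeight S x * f x = 1 / (S.card : ℝ) * ∑ x ∈ S, f x := by
  classical
  rw [Finset.mul_sum, ← Finset.sum_subset hSU]
  · exact Finset.sum_congr rfl fun x hx => by simp [uniformWeight, hx]
  · intro x _ hx
    simp [uniformWeight, hx]

theorem doubleSumKernel_eq_sum {X : Type*} (kin : X → X → ℝ) {S S' U : Finset X}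
    (hS : S ⊆ U) (hS' : S' ⊆ U) :
    doubleSumKernel kin S S' =
      ∑ x ∈ U, ∑ y ∈ U, uniformWeight S x * uniformWeight S' y * kin x y := by
  simp_rw [mul_assoc, ← Finset.mul_sum, sum_uniformWeight_mul hS', sum_uniformWeight_mul hS,
    ← Finset.mul_sum]
  rw [doubleSumKernel, ← mul_assoc, one_div_mul_one_div]

theorem doubleSumKernel_comm {X : Type*} (kin : X → X → ℝ)
    (hsymm : ∀ x y : X, kin x y = kin y x) (S S' : Finset X) :
    doubleSumKernel kin S S' = doubleSumKernel kin S' S := by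
  rw [doubleSumKernel, doubleSumKernel, mul_comm (S.card : ℝ), Finset.sum_comm]
  exact congrArg _ (Finset.sum_congr rfl fun y _ => Finset.sum_congr rfl fun x _ => hsymm x y)

/-- a strictly positive definite kernel `kin` satisfies condition (i);
consequently the canonical pseudometric `dE` of its double sum kernel is a metric on the
nonempty finite subsets of `X`. -/
theorem condI_of_strictPosDef {X : Type*} (kin : X → X → ℝ)
    (hsymm : ∀ x y : X, kin x y = kin y x)
    (hpd : ∀ (n : ℕ) (t : Fin n → X) (a : Fin n → ℝ),
      0 ≤ ∑ i, ∑ j, a i * a j * kin (t i) (t j))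
    (hspd : ∀ (n : ℕ) (t : Fin n → X), Function.Injective t →
      ∀ a : Fin n → ℝ, a ≠ 0 → 0 < ∑ i, ∑ j, a i * a j * kin (t i) (t j)) :
    CondI kin ∧
    (∀ S S' : Finset X, S.Nonempty → S'.Nonempty → S ≠ S' → 0 < dE kin S S') := by
  constructor
  · intro n₁ n₂ ℓ h₁ h₂ hℓ _ hne x hx
    refine hspd _ x hx (fun i => if (i : ℕ) < n₁ - ℓ then (1 : ℝ) / (n₁ : ℝ)
      else if (i : ℕ) < n₁ then 1 / (n₁ : ℝ) - 1 / (n₂ : ℝ) else -(1 / (n₂ : ℝ))) fun h0 => ?_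
    by_cases hlt : ℓ < n₁
    · have h := congrFun h0 ⟨0, by omega⟩
      have hn : n₁ ≠ 0 := by omega
      simp [hlt, hn] at h
    · have h := congrFun h0 ⟨n₁ + n₂ - ℓ - 1, by omega⟩
      have hn : n₂ ≠ 0 := by omega
      have ha : ¬ n₁ + n₂ - ℓ - 1 < n₁ - ℓ := by omega
      have hb : ¬ n₁ + n₂ - ℓ - 1 < n₁ := by omega
      simp [ha, hb, hn] at h
  · intro S S' hS hS' hne
    classical
    have hc : ∃ x ∈ S ∪ S', uniformWeight S x - uniformWeight S' x ≠ 0 := by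
      by_contra! h
      exact hne (uniformWeight_injective hS hS' fun x hx =>
        sub_eq_zero.mp (h x (Finset.mem_union.mpr hx)))
    have hpos := quadratic_form_pos_of_strictPosDef kin hspd (S ∪ S') _ hc
    have hl : S ⊆ S ∪ S' := Finset.subset_union_left
    have hr : S' ⊆ S ∪ S' := Finset.subset_union_right
    refine Real.sqrt_pos.mpr (hpos.trans_eq ?_)
    rw [two_mul]
    nth_rewrite 2 [doubleSumKernel_comm kin hsymm S S']
    rw [doubleSumKernel_eq_sum kin hl hl, doubleSumKernel_eq_sum kin hr hr,
      doubleSumKernel_eq_sum kin hl hr, doubleSumKernel_eq_sum kin hr hl]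
    simp_rw [← Finset.sum_add_distrib, ← Finset.sum_sub_distrib]
    exact Finset.sum_congr rfl fun x _ => Finset.sum_congr rfl fun y _ => by ring
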